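/- Let K ⊊ J ⊆ ∘I with J nonempty, and let λ ∈ ∘Q^∨_J satisfy (α_j | λ) > 0 for all j ∈ J∖K and (α_k | λ) = 0 for all k ∈ K. Choose a reduced expression t_λ = s(1)⋯s(n) in (W_J, S_J), and extend s periodically by s(p) = s(p̄) where 1 ≤ p̄ ≤ n and p̄ ≡ p mod n. Then the infinite sequence s = (s(p))_{p∈ℕ} is an infinite reduced word of (W_J, S_J) and ⋃_{p∈ℕ} Φ_J(s(1)⋯s(p)) = Δ^K_J(1, −). -/

import Mathlib

open scoped Pointwise

section

variable {ι V : Type*} [Fintype ι] [Nonempty ι] [AddCommGroup V] [Module ℝ V]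

/-- The length of `w` with respect to a generating set `S` of a group. -/
noncomputable def lenG {G : Type*} [Group G] (S : Set G) (w : G) : ℕ :=
  sInf {n | ∃ l : List G, (∀ x ∈ l, x ∈ S) ∧ l.length = n ∧ l.prod = w}

/-- `v` is a nonnegative linear combination of the simple roots `α` of `∘Δ`. -/
def PosoComb (α : ι → V) (v : V) : Prop :=
  ∃ c : ι → ℝ, (∀ i, 0 ≤ c i) ∧ v = ∑ i, c i • α i

/-- The parabolic subgroup `∘W_J = ⟨s_j | j ∈ J⟩` of the finite Weyl group, realized
inside the group of linear automorphisms of `𝔥* = V`. -/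
def WoJ (α : ι → V) (s : V → V ≃ₗ[ℝ] V) (J : Set ι) : Subgroup (V ≃ₗ[ℝ] V) :=
  Subgroup.closure ((fun j => s (α j)) '' J)

/-- `∘Δ_J = ∘W_J(∘Π_J)` (so `∘Δ_∅ = ∅`). -/
def DeloJ (α : ι → V) (s : V → V ≃ₗ[ℝ] V) (J : Set ι) : Set V :=
  {v | ∃ g ∈ WoJ α s J, ∃ j ∈ J, v = g (α j)}

/-- `∘Δ`, the root system of the underlying finite-dimensional simple Lie algebra. -/
def Delo (α : ι → V) (s : V → V ≃ₗ[ℝ] V) : Set V := DeloJ α s Set.univ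

/-- `∘Δ^K_{J+} = (∘Δ_J ∖ ∘Δ_K) ∩ ∘Δ₊`. -/
def DeloKJpos (α : ι → V) (s : V → V ≃ₗ[ℝ] V) (J K : Set ι) : Set V :=
  (DeloJ α s J \ DeloJ α s K) ∩ {v | PosoComb α v}

/-- `∘Δ^K_{J−} = (∘Δ_J ∖ ∘Δ_K) ∩ ∘Δ₋`. -/
def DeloKJneg (α : ι → V) (s : V → V ≃ₗ[ℝ] V) (J K : Set ι) : Set V :=
  (DeloJ α s J \ DeloJ α s K) ∩ {v | PosoComb α (-v)}

/-- The set `∘W^K_J` of minimal-length representatives of the right cosets `∘W_J/∘W_K`. -/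
def MinReps (α : ι → V) (s : V → V ≃ₗ[ℝ] V) (J K : Set ι) : Set (V ≃ₗ[ℝ] V) :=
  {w | w ∈ WoJ α s J ∧ ∀ v ∈ WoJ α s K,
    lenG (Set.range fun i => s (α i)) w ≤ lenG (Set.range fun i => s (α i)) (w * v)}

/-- The affine simple roots `Π = {α₀ = δ − θ} ∪ ∘Π`, indexed by `Option ι`. -/
def alHat (α : ι → V) (δ θ : V) : Option ι → V := fun o => o.elim (δ - θ) α

/-- `v` is a nonnegative linear combination of the affine simple roots. -/
def PosComb (α : ι → V) (δ θ : V) (v : V) : Prop :=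
  ∃ c : Option ι → ℝ, (∀ o, 0 ≤ c o) ∧ v = ∑ o, c o • alHat α δ θ o

/-- The real roots `Δ^re = {mδ + ε | m ∈ ℤ, ε ∈ ∘Δ}`. -/
def DelRe (α : ι → V) (δ : V) (s : V → V ≃ₗ[ℝ] V) : Set V :=
  {v | ∃ m : ℤ, ∃ ε ∈ Delo α s, v = m • δ + ε}

/-- The imaginary roots `Δ^im = {mδ | m ∈ ℤ ∖ {0}}`. -/
def DelIm (δ : V) : Set V := {v | ∃ m : ℤ, m ≠ 0 ∧ v = m • δ}

/-- The affine root system `Δ = Δ^re ∪ Δ^im`. -/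
def Del (α : ι → V) (δ : V) (s : V → V ≃ₗ[ℝ] V) : Set V := DelRe α δ s ∪ DelIm δ

/-- The positive roots `Δ₊` (relative to `Π`). -/
def DelPos (α : ι → V) (δ θ : V) (s : V → V ≃ₗ[ℝ] V) : Set V :=
  {v ∈ Del α δ s | PosComb α δ θ v}

/-- The negative roots `Δ₋ = −Δ₊`. -/
def DelNeg (α : ι → V) (δ θ : V) (s : V → V ≃ₗ[ℝ] V) : Set V :=
  {v | -v ∈ DelPos α δ θ s}

/-- `Δ^re₊ = Δ^re ∩ Δ₊`. -/
def DelRePos (α : ι → V) (δ θ : V) (s : V → V ≃ₗ[ℝ] V) : Set V :=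
  DelRe α δ s ∩ DelPos α δ θ s

/-- `Δ^im₊ = {mδ | m ≥ 1}`. -/
def DelImPos (δ : V) : Set V := {v | ∃ m : ℕ, 0 < m ∧ v = (m : ℤ) • δ}

/-- `⟨ε⟩ = {mδ + ε | m ∈ ℤ≥0} ∩ Δ^re₊`. -/
def brkt (α : ι → V) (δ θ : V) (s : V → V ≃ₗ[ℝ] V) (ε : V) : Set V :=
  {v | ∃ m : ℕ, v = (m : ℤ) • δ + ε} ∩ DelRePos α δ θ s

/-- `⟨P⟩ = ⋃_{ε ∈ P} ⟨ε⟩`. -/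
def brSet (α : ι → V) (δ θ : V) (s : V → V ≃ₗ[ℝ] V) (P : Set V) : Set V :=
  ⋃ ε ∈ P, brkt α δ θ s ε

/-- `Δ^re_J = {mδ + ε | m ∈ ℤ, ε ∈ ∘Δ_J}`. -/
def DelReJ (α : ι → V) (δ : V) (s : V → V ≃ₗ[ℝ] V) (J : Set ι) : Set V :=
  {v | ∃ m : ℤ, ∃ ε ∈ DeloJ α s J, v = m • δ + ε}

/-- `Δ_J = Δ^re_J ∪ Δ^im`. -/
def DelJ (α : ι → V) (δ : V) (s : V → V ≃ₗ[ℝ] V) (J : Set ι) : Set V :=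
  DelReJ α δ s J ∪ DelIm δ

/-- `Δ_{J+} = Δ_J ∩ Δ₊`. -/
def DelJPos (α : ι → V) (δ θ : V) (s : V → V ≃ₗ[ℝ] V) (J : Set ι) : Set V :=
  DelJ α δ s J ∩ DelPos α δ θ s

/-- `Δ_{J+} = ⟨∘Δ_J⟩ ∪ Δ^im₊` (the description used from Section 5 onwards). -/
def DelJPosB (α : ι → V) (δ θ : V) (s : V → V ≃ₗ[ℝ] V) (J : Set ι) : Set V :=
  brSet α δ θ s (DeloJ α s J) ∪ DelImPos δ

/-- The set of highest roots of the irreducible components of `∘Δ_J`, i.e. the maximal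
elements of `∘Δ_{J+}`: the positive roots `ε` of `∘Δ_J` such that no `ε + α_j` is a root. -/
def HighRoots (α : ι → V) (s : V → V ≃ₗ[ℝ] V) (J : Set ι) : Set V :=
  {ε ∈ DeloJ α s J | PosoComb α ε ∧ ∀ j ∈ J, ε + α j ∉ DeloJ α s J}

/-- `Π_J = ∘Π_J ⊔ {δ − θ_{J_c} | c}`. -/
def PiJ (α : ι → V) (δ : V) (s : V → V ≃ₗ[ℝ] V) (J : Set ι) : Set V :=
  (α '' J) ∪ (fun x => δ - x) '' HighRoots α s J

/-- `S_J = {s_α | α ∈ Π_J}`. -/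
def SJ (α : ι → V) (δ : V) (s : V → V ≃ₗ[ℝ] V) (J : Set ι) : Set (V ≃ₗ[ℝ] V) :=
  s '' PiJ α δ s J

/-- `W_J = ⟨S_J⟩` (so `W_∅ = {1}`). -/
def WJ (α : ι → V) (δ : V) (s : V → V ≃ₗ[ℝ] V) (J : Set ι) : Subgroup (V ≃ₗ[ℝ] V) :=
  Subgroup.closure (SJ α δ s J)

/-- `Φ_J(y) = {β ∈ Δ_{J+} | y⁻¹(β) < 0}`, with `Δ_{J+} = Δ_J ∩ Δ₊`. -/
def PhiJ (α : ι → V) (δ θ : V) (s : V → V ≃ₗ[ℝ] V) (J : Set ι) (y : V ≃ₗ[ℝ] V) : Set V :=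
  {β ∈ DelJPos α δ θ s J | y⁻¹ β ∈ DelNeg α δ θ s}

/-- `Φ_J(y) = {β ∈ Δ_{J+} | y⁻¹(β) < 0}`, with `Δ_{J+} = ⟨∘Δ_J⟩ ∪ Δ^im₊`. -/
def PhiJb (α : ι → V) (δ θ : V) (s : V → V ≃ₗ[ℝ] V) (J : Set ι) (y : V ≃ₗ[ℝ] V) : Set V :=
  {β ∈ DelJPosB α δ θ s J | y⁻¹ β ∈ DelNeg α δ θ s}

/-- `Δ^K_J(u, −) = ⟨u∘Δ^K_{J−}⟩`. -/
def DKJm (α : ι → V) (δ θ : V) (s : V → V ≃ₗ[ℝ] V) (J K : Set ι) (u : V ≃ₗ[ℝ] V) : Set V :=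
  brSet α δ θ s (⇑u '' DeloKJneg α s J K)

/-- `Δ^K_J(u, +) = ⟨u∘Δ^K_{J+}⟩`. -/
def DKJp (α : ι → V) (δ θ : V) (s : V → V ≃ₗ[ℝ] V) (J K : Set ι) (u : V ≃ₗ[ℝ] V) : Set V :=
  brSet α δ θ s (⇑u '' DeloKJpos α s J K)

/-- `B` is a convex set in `A`: `B ⊆ A` and `β, γ ∈ B`, `β + γ ∈ A` imply `β + γ ∈ B`. -/
def ConvexIn (A B : Set V) : Prop :=
  B ⊆ A ∧ ∀ x ∈ B, ∀ y ∈ B, x + y ∈ A → x + y ∈ B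

/-- `B` is a biconvex set in `A`: both `B` and `A ∖ B` are convex sets in `A`. -/
def BiconvexIn (A B : Set V) : Prop :=
  ConvexIn A B ∧ ConvexIn A (A \ B)

/-- `P ⊆ ∘Δ` is a closed set. -/
def ClosedIn (Δo P : Set V) : Prop :=
  ∀ ε ∈ P, ∀ η ∈ P, ε + η ∈ Δo → ε + η ∈ P

/-- The coroot `α_j^∨ = 2α_j/(α_j|α_j)`. -/
noncomputable def coroot (α : ι → V) (B : V →ₗ[ℝ] V →ₗ[ℝ] ℝ) (j : ι) : V :=
  (2 / B (α j) (α j)) • α j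

/-- The coroot lattice `∘Q^∨_J = ⊕_{j ∈ J} ℤ α_j^∨`. -/
def QJ (α : ι → V) (B : V →ₗ[ℝ] V →ₗ[ℝ] ℝ) (J : Set ι) : Set V :=
  {lam | ∃ c : ι → ℤ, (∀ j, j ∉ J → c j = 0) ∧ lam = ∑ j, c j • coroot α B j}

/-- `g` acts as the translation `t_λ`: `g(μ) = μ − (μ|λ)δ` for `μ` in the span of `Π`. -/
def IsTransl (α : ι → V) (δ θ : V) (B : V →ₗ[ℝ] V →ₗ[ℝ] ℝ) (lam : V)
    (g : V ≃ₗ[ℝ] V) : Prop :=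
  ∀ μ ∈ Submodule.span ℝ (Set.range (alHat α δ θ)), g μ = μ - B μ lam • δ

/-- The translation subgroup `T_J = {t_λ | λ ∈ ∘Q^∨_J}` of `W_J`. -/
def TJ (α : ι → V) (δ θ : V) (B : V →ₗ[ℝ] V →ₗ[ℝ] ℝ) (s : V → V ≃ₗ[ℝ] V)
    (J : Set ι) : Set (V ≃ₗ[ℝ] V) :=
  {g | g ∈ WJ α δ s J ∧ ∃ lam ∈ QJ α B J, IsTransl α δ θ B lam g}

/-- The hypotheses describing the root datum of an untwisted affine Kac–Moody Lie algebra
over `ℝ`: `α` are the simple roots of the underlying finite-dimensional simple Lie algebra,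
`δ` is the null root, `θ` the highest root of `∘Δ`, `B` the standard invariant bilinear form,
and `s a` the reflection in a (real) root `a`. -/
structure AffineSetup (α : ι → V) (δ θ : V) (B : V →ₗ[ℝ] V →ₗ[ℝ] ℝ)
    (s : V → V ≃ₗ[ℝ] V) : Prop where
  indep : LinearIndependent ℝ (alHat α δ θ)
  Bsymm : ∀ u v : V, B u v = B v u
  Bpos : ∀ v ∈ Delo α s, 0 < B v v
  refl_def : ∀ a : V, B a a ≠ 0 → ∀ v : V, s a v = v - (2 * B v a / B a a) • a
  delta_orth : ∀ i : ι, B δ (α i) = 0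
  delta_null : B δ δ = 0
  theta_high : θ ∈ HighRoots α s Set.univ
  cryst : ∀ i : ι, ∀ v ∈ Delo α s, ∃ m : ℤ, s (α i) v = v - m • α i
  base : ∀ v ∈ Delo α s, Xor' (PosoComb α v) (PosoComb α (-v))
  finite : (Delo α s).Finite
  reduced : ∀ v ∈ Delo α s, (2 : ℝ) • v ∉ Delo α s
  irred : ∀ A : Set ι, (∀ i ∈ A, ∀ j ∈ Aᶜ, s (α i) (α j) = α j) → A = ∅ ∨ A = Set.univ

theorem ax_functional {κ V : Type*} [AddCommGroup V] [Module ℝ V] {v : κ → V}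
    (hli : LinearIndependent ℝ v) (g : κ → ℝ) : ∃ f : V →ₗ[ℝ] ℝ, ∀ i, f (v i) = g i := by
  obtain ⟨f, hf⟩ := LinearMap.exists_extend ((Module.Basis.span hli).constr ℝ g)
  refine ⟨f, fun i => ?_⟩
  have h1 := congrArg (fun F => F (Module.Basis.span hli i)) hf
  simp only [LinearMap.comp_apply, Module.Basis.constr_basis] at h1
  rw [← h1]
  simp [Module.Basis.span_apply]

section roots

variable {α : ι → V} {δ θ : V} {B : V →ₗ[ℝ] V →ₗ[ℝ] ℝ} {s : V → V ≃ₗ[ℝ] V}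


theorem ax_refl_inv (h : AffineSetup α δ θ B s) {a : V} (ha : B a a ≠ 0) (u v : V) :
    B (s a u) (s a v) = B u v := by
  rw [h.refl_def a ha, h.refl_def a ha]
  simp only [map_sub, map_smul, LinearMap.sub_apply, LinearMap.smul_apply, smul_eq_mul]
  rw [h.Bsymm a v]
  field_simp
  ring

theorem ax_refl_self (h : AffineSetup α δ θ B s) {a : V} (ha : B a a ≠ 0) : s a a = -a := by
  rw [h.refl_def a ha]
  have : 2 * B a a / B a a = 2 := by field_simp
  rw [this, two_smul]; abel

theorem ax_refl_sq (h : AffineSetup α δ θ B s) {a : V} (ha : B a a ≠ 0) : s a * s a = 1 := by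
  ext v
  change s a (s a v) = v
  have h1 := h.refl_def a ha v
  rw [h1, map_sub, map_smul, ax_refl_self h ha, h1]
  simp

theorem ax_conj (h : AffineSetup α δ θ B s) {a b : V} (ha : B a a ≠ 0) {w : V ≃ₗ[ℝ] V}
    (hw : ∀ u v, B (w u) (w v) = B u v) (hb : w a = b) : w * s a = s b * w := by
  ext v
  change w (s a v) = s b (w v)
  have hb' : B b b ≠ 0 := by rw [← hb, hw]; exact ha
  rw [h.refl_def a ha, h.refl_def b hb', ← hb, hw, hw]
  simp

theorem ax_simple_mem (α : ι → V) (s : V → V ≃ₗ[ℝ] V) {J : Set ι} {j : ι} (hj : j ∈ J) :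
    α j ∈ DeloJ α s J :=
  ⟨1, Subgroup.one_mem _, j, hj, rfl⟩

theorem ax_simple_ne (h : AffineSetup α δ θ B s) (j : ι) : B (α j) (α j) ≠ 0 :=
  (h.Bpos _ (ax_simple_mem α s (Set.mem_univ j))).ne'

theorem ax_WoJ_mono (α : ι → V) (s : V → V ≃ₗ[ℝ] V) {J K : Set ι} (hJK : J ⊆ K) :
    WoJ α s J ≤ WoJ α s K :=
  Subgroup.closure_mono (Set.image_mono hJK)

theorem ax_DeloJ_mono (α : ι → V) (s : V → V ≃ₗ[ℝ] V) {J K : Set ι} (hJK : J ⊆ K) :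
    DeloJ α s J ⊆ DeloJ α s K := by
  rintro v ⟨g, hg, j, hj, rfl⟩
  exact ⟨g, ax_WoJ_mono α s hJK hg, j, hJK hj, rfl⟩

theorem ax_DeloJ_sub (α : ι → V) (s : V → V ≃ₗ[ℝ] V) {J : Set ι} {v : V}
    (hv : v ∈ DeloJ α s J) : v ∈ Delo α s :=
  ax_DeloJ_mono α s (Set.subset_univ J) hv

theorem ax_WoJ_inv (h : AffineSetup α δ θ B s) {J : Set ι} {g : V ≃ₗ[ℝ] V}
    (hg : g ∈ WoJ α s J) : ∀ u v, B (g u) (g v) = B u v := by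
  induction hg using Subgroup.closure_induction with
  | mem x hx =>
    obtain ⟨j, _, rfl⟩ := hx
    exact fun u v => ax_refl_inv h (ax_simple_ne h j) u v
  | one => intro u v; rfl
  | mul x y _ _ hx hy => intro u v; exact (hx _ _).trans (hy _ _)
  | inv x _ hx =>
    intro u v
    rw [← hx (x⁻¹ u) (x⁻¹ v)]
    change B (x (x.symm u)) (x (x.symm v)) = _
    simp

theorem ax_WoJ_act {J : Set ι} {g : V ≃ₗ[ℝ] V} (hg : g ∈ WoJ α s J) {v : V}
    (hv : v ∈ DeloJ α s J) : g v ∈ DeloJ α s J := by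
  obtain ⟨w, hw, j, hj, rfl⟩ := hv
  exact ⟨g * w, Subgroup.mul_mem _ hg hw, j, hj, rfl⟩

theorem ax_root_pos (h : AffineSetup α δ θ B s) {J : Set ι} {v : V}
    (hv : v ∈ DeloJ α s J) : 0 < B v v := h.Bpos _ (ax_DeloJ_sub α s hv)

theorem ax_refl_mem (h : AffineSetup α δ θ B s) {J : Set ι} {v : V}
    (hv : v ∈ DeloJ α s J) : s v ∈ WoJ α s J := by
  obtain ⟨w, hw, j, hj, hvw⟩ := hv
  have h1 := ax_conj h (ax_simple_ne h j) (ax_WoJ_inv h hw) hvw.symm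
  have h2 : s v = w * s (α j) * w⁻¹ := by rw [h1]; group
  rw [h2]
  exact Subgroup.mul_mem _ (Subgroup.mul_mem _ hw (Subgroup.subset_closure ⟨j, hj, rfl⟩))
    (Subgroup.inv_mem _ hw)

theorem ax_refl_act (h : AffineSetup α δ θ B s) {J : Set ι} {v u : V}
    (hv : v ∈ DeloJ α s J) (hu : u ∈ DeloJ α s J) : s v u ∈ DeloJ α s J :=
  ax_WoJ_act (ax_refl_mem h hv) hu

theorem ax_neg_mem (h : AffineSetup α δ θ B s) {J : Set ι} {v : V}
    (hv : v ∈ DeloJ α s J) : -v ∈ DeloJ α s J := by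
  rw [← ax_refl_self h (ax_root_pos h hv).ne']
  exact ax_refl_act h hv hv

theorem ax_int (h : AffineSetup α δ θ B s) {J : Set ι} {v u : V}
    (hv : v ∈ DeloJ α s J) (hu : u ∈ DeloJ α s J) : ∃ n : ℤ, 2 * B u v / B v v = n := by
  obtain ⟨w, hw, j, hj, rfl⟩ := hv
  have hinv := ax_WoJ_inv h hw
  have hu' := ax_WoJ_act (Subgroup.inv_mem _ hw) hu
  obtain ⟨m, hm⟩ := h.cryst j _ (ax_DeloJ_sub α s hu')
  refine ⟨m, ?_⟩
  rw [h.refl_def _ (ax_simple_ne h j)] at hm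
  have h1 : B u (w (α j)) = B (w⁻¹ u) (α j) := by
    rw [← hinv (w⁻¹ u)]
    change _ = B (w (w.symm u)) _
    simp
  rw [hinv, h1]
  have h2 : (2 * B (w⁻¹ u) (α j) / B (α j) (α j)) • α j = (m : ℝ) • α j := by
    rw [Int.cast_smul_eq_zsmul]
    exact sub_right_injective hm
  have h3 : α j ≠ 0 := by
    intro h0
    apply ax_simple_ne h j
    rw [h0]; simp
  exact smul_left_injective ℝ h3 h2

theorem ax_refl_int (h : AffineSetup α δ θ B s) {J : Set ι} {v u : V} {n : ℤ}
    (hv : v ∈ DeloJ α s J) (hn : 2 * B u v / B v v = n) : s v u = u - (n : ℝ) • v := by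
  rw [h.refl_def _ (ax_root_pos h hv).ne', hn]

theorem ax_J_finite (h : AffineSetup α δ θ B s) (J : Set ι) : (DeloJ α s J).Finite :=
  h.finite.subset (ax_DeloJ_mono α s (Set.subset_univ J))

theorem ax_cs (h : AffineSetup α δ θ B s) {J : Set ι} {a b : V}
    (ha : a ∈ DeloJ α s J) (hb : b ∈ DeloJ α s J) :
    (2 * B a b / B b b) * (2 * B b a / B a a) ≤ 4 := by
  classical
  let F : Finset V := (ax_J_finite h J).toFinset
  have hF : ∀ x, x ∈ F ↔ x ∈ DeloJ α s J := fun x => Set.Finite.mem_toFinset _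
  let C : V → V → ℝ := fun u v => ∑ e ∈ F, B u e * B v e
  have hCsymm : ∀ u v, C u v = C v u := fun u v => Finset.sum_congr rfl fun e _ => mul_comm _ _
  have hCinv : ∀ x ∈ DeloJ α s J, ∀ u v, C (s x u) (s x v) = C u v := by
    intro x hx u v
    have hx0 := (ax_root_pos h hx).ne'
    have hss : ∀ e, s x (s x e) = e := fun e => by
      have := ax_refl_sq h hx0
      exact congrArg (fun g : V ≃ₗ[ℝ] V => g e) this
    refine Finset.sum_nbij' (fun e => s x e) (fun e => s x e) ?_ ?_ ?_ ?_ ?_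
    · intro e he; rw [hF] at he ⊢; exact ax_refl_act h hx he
    · intro e he; rw [hF] at he ⊢; exact ax_refl_act h hx he
    · intro e _; exact hss e
    · intro e _; exact hss e
    · intro e _
      have := fun u => ax_refl_inv h hx0 u (s x e)
      simp only [hss] at this
      rw [this, this]
  have hCpos : ∀ x ∈ DeloJ α s J, 0 < C x x := by
    intro x hx
    refine Finset.sum_pos' (fun e _ => mul_self_nonneg _) ⟨x, (hF x).2 hx, ?_⟩
    have := ax_root_pos h hx
    positivity
  have hCform : ∀ x ∈ DeloJ α s J, ∀ u, 2 * C u x = (2 * B u x / B x x) * C x x := by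
    intro x hx u
    have h1 := hCinv x hx u x
    rw [ax_refl_self h (ax_root_pos h hx).ne', h.refl_def x (ax_root_pos h hx).ne'] at h1
    set c := 2 * B u x / B x x
    have h2 : C (u - c • x) (-x) = -(C u x) + c * C x x := by
      simp only [C, Finset.mul_sum, ← Finset.sum_neg_distrib, ← Finset.sum_add_distrib]
      refine Finset.sum_congr rfl fun e _ => ?_
      simp
      ring
    linarith
  have hCS : (C a b) ^ 2 ≤ C a a * C b b := by
    have := Finset.sum_mul_sq_le_sq_mul_sq F (fun e => B a e) (fun e => B b e)
    simpa only [C, sq] using this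
  have e1 := hCform b hb a
  have e2 := hCform a ha b
  rw [hCsymm b a] at e2
  set p := 2 * B a b / B b b
  set q := 2 * B b a / B a a
  have p1 := hCpos a ha
  have p2 := hCpos b hb
  have : (p * q) * (C a a * C b b) ≤ 4 * (C a a * C b b) := by
    calc (p * q) * (C a a * C b b) = (2 * C a b) * (2 * C a b) := by
          nth_rewrite 1 [e1]; rw [e2]; ring
      _ = 4 * (C a b)^2 := by ring
      _ ≤ _ := by linarith
  exact le_of_mul_le_mul_right this (by positivity)

theorem ax_sub (h : AffineSetup α δ θ B s) {J : Set ι} {a b : V}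
    (ha : a ∈ DeloJ α s J) (hb : b ∈ DeloJ α s J) (hab : 0 < B a b) (hne : a ≠ b) :
    a - b ∈ DeloJ α s J := by
  have pa := ax_root_pos h ha
  have pb := ax_root_pos h hb
  obtain ⟨p, hp⟩ := ax_int h hb ha
  obtain ⟨q, hq⟩ := ax_int h ha hb
  have hcs := ax_cs h ha hb
  have rb := ax_refl_int h hb hp
  have ra := ax_refl_int h ha hq
  have hba : 0 < B b a := by rw [h.Bsymm]; exact hab
  have hp0 : 0 < p := by
    have : (0 : ℝ) < p := by rw [← hp]; positivity
    exact_mod_cast this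
  have hq0 : 0 < q := by
    have : (0 : ℝ) < q := by rw [← hq]; positivity
    exact_mod_cast this
  rw [hp, hq] at hcs
  have hcs' : p * q ≤ 4 := by exact_mod_cast hcs
  by_cases hp1 : p = 1
  · have := ax_refl_act h hb ha
    rw [rb, hp1] at this
    simpa using this
  by_cases hq1 : q = 1
  · have := ax_neg_mem h (ax_refl_act h ha hb)
    rw [ra, hq1] at this
    simpa using this
  exfalso
  have hp2 : p = 2 := by nlinarith [show 2 ≤ p by omega, show 2 ≤ q by omega]
  have hq2 : q = 2 := by nlinarith [show 2 ≤ p by omega, show 2 ≤ q by omega]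
  subst hp2 hq2
  have e1 : B a b = B b b := by
    rw [div_eq_iff pb.ne'] at hp; push_cast at hp; linarith
  have e2 : B b a = B a a := by
    rw [div_eq_iff pa.ne'] at hq; push_cast at hq; linarith
  have e3 := h.Bsymm a b
  have key : ∀ k : ℕ, b + ((2 * k : ℕ) : ℝ) • (a - b) ∈ DeloJ α s J := by
    intro k
    induction k with
    | zero => simpa using hb
    | succ k ih =>
      have h1 := ax_refl_act h ha (ax_refl_act h hb ih)
      have hu : s b (a - b) = a - b := by
        rw [h.refl_def b pb.ne']
        have : B (a - b) b = 0 := by simp; linarith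
        rw [this]; simp
      have hu' : s a (a - b) = a - b := by
        rw [h.refl_def a pa.ne']
        have : B (a - b) a = 0 := by simp; linarith
        rw [this]; simp
      rw [map_add, map_add, map_smul, map_smul, hu, hu', ax_refl_self h pb.ne', map_neg, ra] at h1
      convert h1 using 1
      push_cast
      module
  have hinj : Function.Injective (fun k : ℕ => b + ((2 * k : ℕ) : ℝ) • (a - b)) := by
    intro k k' hk
    have h1 := smul_left_injective ℝ (sub_ne_zero.2 hne) (add_left_cancel hk)
    have h2 : 2 * k = 2 * k' := by exact_mod_cast h1
    omega
  exact Set.infinite_of_injective_forall_mem hinj key (ax_J_finite h J)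

end roots

section roots2

variable {α : ι → V} {δ θ : V} {B : V →ₗ[ℝ] V →ₗ[ℝ] ℝ} {s : V → V ≃ₗ[ℝ] V}

open Classical in
theorem ax_coord_exists (h : AffineSetup α δ θ B s) :
    ∃ f : ι → V →ₗ[ℝ] ℝ, ∀ i k, f i (α k) = if i = k then 1 else 0 := by
  have := fun i : ι => ax_functional h.indep (fun o => if o = some i then 1 else 0)
  choose f hf using this
  refine ⟨f, fun i k => ?_⟩
  have := hf i (some k)
  simp only [alHat, Option.elim_some] at this
  rw [this]
  simp [eq_comm]

/-- Coordinate functionals with respect to the simple roots. -/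
noncomputable def axc (h : AffineSetup α δ θ B s) : ι → V →ₗ[ℝ] ℝ :=
  (ax_coord_exists h).choose

open Classical in
theorem axc_simple (h : AffineSetup α δ θ B s) (i k : ι) :
    axc h i (α k) = if i = k then 1 else 0 := (ax_coord_exists h).choose_spec i k

theorem axc_sum (h : AffineSetup α δ θ B s) (c : ι → ℝ) (i : ι) :
    axc h i (∑ k, c k • α k) = c i := by
  classical
  simp [axc_simple]

theorem ax_span (h : AffineSetup α δ θ B s) {J : Set ι} {v : V} (hv : v ∈ DeloJ α s J) :
    ∃ c : ι → ℝ, (∀ i, i ∉ J → c i = 0) ∧ v = ∑ k, c k • α k := by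
  classical
  obtain ⟨g, hg, j, hj, rfl⟩ := hv
  have base : ∀ j ∈ J, ∃ c : ι → ℝ, (∀ i, i ∉ J → c i = 0) ∧ α j = ∑ k, c k • α k := by
    intro j hj
    refine ⟨fun k => if k = j then 1 else 0, fun i hi => ?_, by simp⟩
    have : i ≠ j := fun e => hi (e ▸ hj)
    simp [this]
  have key : ∀ v : V, (∃ c : ι → ℝ, (∀ i, i ∉ J → c i = 0) ∧ v = ∑ k, c k • α k) →
      (∃ c : ι → ℝ, (∀ i, i ∉ J → c i = 0) ∧ g v = ∑ k, c k • α k) ∧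
      (∃ c : ι → ℝ, (∀ i, i ∉ J → c i = 0) ∧ g⁻¹ v = ∑ k, c k • α k) := by
    induction hg using Subgroup.closure_induction with
    | mem x hx =>
      obtain ⟨k, hk, rfl⟩ := hx
      have hinv : (s (α k))⁻¹ = s (α k) :=
        inv_eq_of_mul_eq_one_left (ax_refl_sq h (ax_simple_ne h k))
      intro v hv
      simp only [hinv, and_self]
      obtain ⟨c, hc, rfl⟩ := hv
      obtain ⟨d, hd, hdk⟩ := base k hk
      rw [h.refl_def _ (ax_simple_ne h k)]
      set t := 2 * B (∑ k, c k • α k) (α k) / B (α k) (α k)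
      refine ⟨fun i => c i - t * d i, fun i hi => by simp [hc i hi, hd i hi], ?_⟩
      conv_lhs => rw [hdk]
      simp only [Finset.smul_sum, sub_smul, Finset.sum_sub_distrib, mul_smul]
    | one => intro v hv; simpa using hv
    | mul x y _ _ hx hy =>
      intro v hv
      refine ⟨(hx _ (hy v hv).1).1, ?_⟩
      rw [mul_inv_rev]
      exact (hy _ (hx v hv).2).2
    | inv x _ hx => intro v hv; rw [inv_inv]; exact (hx v hv).symm
  exact (key _ (base j hj)).1

theorem axc_span (h : AffineSetup α δ θ B s) {J : Set ι} {v : V} (hv : v ∈ DeloJ α s J) :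
    v = ∑ k, axc h k v • α k := by
  obtain ⟨c, hc, hcv⟩ := ax_span h hv
  conv_lhs => rw [hcv]
  refine Finset.sum_congr rfl fun k _ => ?_
  rw [hcv, axc_sum]

theorem axc_supp (h : AffineSetup α δ θ B s) {J : Set ι} {v : V} (hv : v ∈ DeloJ α s J)
    {i : ι} (hi : i ∉ J) : axc h i v = 0 := by
  obtain ⟨c, hc, hcv⟩ := ax_span h hv
  rw [hcv, axc_sum, hc i hi]

theorem axc_nonneg (h : AffineSetup α δ θ B s) {v : V} (hv : PosoComb α v) (i : ι) :
    0 ≤ axc h i v := by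
  obtain ⟨c, hc, rfl⟩ := hv
  rw [axc_sum]; exact hc i

theorem ax_pos_of (h : AffineSetup α δ θ B s) {J : Set ι} {v : V} (hv : v ∈ DeloJ α s J)
    (h0 : ∀ i, 0 ≤ axc h i v) : PosoComb α v := ⟨_, h0, axc_span h hv⟩

theorem ax_dich (h : AffineSetup α δ θ B s) {J : Set ι} {v : V} (hv : v ∈ DeloJ α s J) :
    PosoComb α v ∨ PosoComb α (-v) := by
  rcases h.base v (ax_DeloJ_sub α s hv) with h1 | h1
  · exact Or.inl h1.1
  · exact Or.inr h1.1

theorem ax_not_both (h : AffineSetup α δ θ B s) {J : Set ι} {v : V} (hv : v ∈ DeloJ α s J)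
    (h1 : PosoComb α v) (h2 : PosoComb α (-v)) : False := by
  rcases h.base v (ax_DeloJ_sub α s hv) with h3 | h3
  · exact h3.2 h2
  · exact h3.2 h1

theorem ax_D (h : AffineSetup α δ θ B s) :
    ∃ D : V →ₗ[ℝ] ℝ, D δ = 1 ∧ D (δ - θ) = 1 ∧ (∀ i, D (α i) = 0) ∧
      ∀ v ∈ Delo α s, D v = 0 := by
  obtain ⟨D, hD⟩ := ax_functional h.indep (fun o => if o = none then 1 else 0)
  have h1 : ∀ i, D (α i) = 0 := fun i => by simpa [alHat] using hD (some i)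
  have h2 : ∀ v ∈ Delo α s, D v = 0 := by
    intro v hv
    rw [axc_span h hv]
    simp [h1]
  have h3 : D (δ - θ) = 1 := by simpa [alHat] using hD none
  refine ⟨D, ?_, h3, h1, h2⟩
  rw [map_sub, h2 θ h.theta_high.1] at h3
  linarith

theorem ax_prop (h : AffineSetup α δ θ B s) {J : Set ι} {v : V} (hv : v ∈ DeloJ α s J)
    {j : ι} (h0 : ∀ i, i ≠ j → axc h i v = 0) (hp : PosoComb α v) : v = α j := by
  have hvj : v = axc h j v • α j := by
    conv_lhs => rw [axc_span h hv]
    exact Finset.sum_eq_single j (fun i _ hi => by simp [h0 i hi]) (by simp)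
  have hc0 := axc_nonneg h hp j
  set c := axc h j v
  have pv := ax_root_pos h hv
  have hc : 0 < c := by
    rcases hc0.eq_or_lt with h1 | h1
    · rw [← h1, zero_smul] at hvj
      rw [hvj] at pv; simp at pv
    · exact h1
  have hV := ax_DeloJ_sub α s hv
  have hA : α j ∈ Delo α s := ax_simple_mem α s (Set.mem_univ j)
  have pA := h.Bpos _ hA
  obtain ⟨n, hn⟩ := ax_int h hA hV
  obtain ⟨m, hm⟩ := ax_int h hV hA
  have hn' : 2 * c = n := by
    rw [← hn, hvj]; simp only [map_smul, LinearMap.smul_apply, smul_eq_mul]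
    field_simp
  have hm' : 2 / c = m := by
    rw [← hm, hvj]; simp only [map_smul, LinearMap.smul_apply, smul_eq_mul]
    field_simp
  have hnm : n * m = 4 := by
    have : (n : ℝ) * m = 4 := by rw [← hn', ← hm']; field_simp; norm_num
    exact_mod_cast this
  have hn0 : 0 < n := by
    have : (0 : ℝ) < n := by rw [← hn']; positivity
    exact_mod_cast this
  have hm0 : 0 < m := by
    have : (0 : ℝ) < m := by rw [← hm']; positivity
    exact_mod_cast this
  have hn4 : n ≤ 4 := by nlinarith
  have r1 := h.reduced _ hV
  have r2 := h.reduced _ hA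
  have : n = 1 ∨ n = 2 ∨ n = 3 ∨ n = 4 := by omega
  rcases this with rfl | rfl | rfl | rfl
  · exfalso
    apply r1
    rw [hvj, smul_smul, hn']
    simpa using hA
  · have : c = 1 := by push_cast at hn'; linarith
    rw [hvj, this, one_smul]
  · omega
  · exfalso
    apply r2
    have : c = 2 := by push_cast at hn'; linarith
    rw [← this, ← hvj]; exact hV

theorem ax_simple_pos (h : AffineSetup α δ θ B s) (j : ι) : PosoComb α (α j) := by
  classical
  exact ⟨fun k => if k = j then 1 else 0, fun i => by positivity, by simp⟩

/-- subtracting multiples of a simple root from another positive root stays positive -/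
theorem ax_sub_simple_pos (h : AffineSetup α δ θ B s) {J : Set ι} {v : V} {j : ι} {t : ℝ}
    (hv : v ∈ DeloJ α s J) (hp : PosoComb α v) (hne : v ≠ α j)
    (hm : v - t • α j ∈ DeloJ α s J) : PosoComb α (v - t • α j) := by
  rcases ax_dich h hm with h1 | h1
  · exact h1
  exfalso
  apply hne
  refine ax_prop h hv (fun i hi => ?_) hp
  have h2 := axc_nonneg h h1 i
  have h3 := axc_nonneg h hp i
  simp [axc_simple, hi] at h2
  linarith

theorem ax_refl_simple_pos (h : AffineSetup α δ θ B s) {J : Set ι} {v : V} {j : ι} (hj : j ∈ J)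
    (hv : v ∈ DeloJ α s J) (hp : PosoComb α v) (hne : v ≠ α j) : PosoComb α (s (α j) v) := by
  have := ax_refl_act h (ax_simple_mem α s hj) hv
  rw [h.refl_def _ (ax_simple_ne h j)] at this ⊢
  exact ax_sub_simple_pos h hv hp hne this

theorem ax_exists_simple (h : AffineSetup α δ θ B s) {J : Set ι} {v : V}
    (hv : v ∈ DeloJ α s J) (hp : PosoComb α v) : ∃ j ∈ J, axc h j v ≠ 0 ∧ 0 < B v (α j) := by
  by_contra hcon
  push Not at hcon
  have pv := ax_root_pos h hv
  have : B v v = ∑ k, axc h k v * B v (α k) := by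
    conv_lhs => rw [axc_span h hv]
    rw [← axc_span h hv, axc_span h hv, ← axc_span h hv]
    conv_lhs => arg 2; rw [axc_span h hv]
    simp
  have h2 : B v v ≤ 0 := by
    rw [this]
    refine Finset.sum_nonpos fun k _ => ?_
    by_cases hk : k ∈ J
    · by_cases hz : axc h k v = 0
      · simp [hz]
      · exact mul_nonpos_of_nonneg_of_nonpos (axc_nonneg h hp k) (hcon k hk hz)
    · simp [axc_supp h hv hk]
  linarith

/-- pairing of a positive root with something nonnegative on simple roots -/
theorem ax_pair_nonneg (h : AffineSetup α δ θ B s) {J : Set ι} {v x : V}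
    (hv : v ∈ DeloJ α s J) (hp : PosoComb α v) (hx : ∀ j ∈ J, 0 ≤ B (α j) x) : 0 ≤ B v x := by
  have : B v x = ∑ k, axc h k v * B (α k) x := by
    conv_lhs => rw [axc_span h hv]
    simp
  rw [this]
  refine Finset.sum_nonneg fun k _ => ?_
  by_cases hk : k ∈ J
  · exact mul_nonneg (axc_nonneg h hp k) (hx k hk)
  · simp [axc_supp h hv hk]

theorem ax_ht (h : AffineSetup α δ θ B s) : ∃ H : V →ₗ[ℝ] ℝ, ∀ i, H (α i) = 1 := by
  obtain ⟨D, hD⟩ := ax_functional h.indep (fun _ => 1)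
  exact ⟨D, fun i => hD (some i)⟩

/-- a positive root supported in `K` lies in `∘Δ_K` -/
theorem ax_supp_mem (h : AffineSetup α δ θ B s) {K : Set ι} {v : V}
    (hv : v ∈ Delo α s) (hp : PosoComb α v) (h0 : ∀ i, i ∉ K → axc h i v = 0) :
    v ∈ DeloJ α s K := by
  obtain ⟨H, hH⟩ := ax_ht h
  by_contra hcon
  let T : Set V := {v | v ∈ Delo α s ∧ PosoComb α v ∧ (∀ i, i ∉ K → axc h i v = 0) ∧
    v ∉ DeloJ α s K}
  have hT : T.Finite := h.finite.subset fun v hv => hv.1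
  obtain ⟨g, hg, hmin⟩ := Set.exists_min_image T H hT ⟨v, hv, hp, h0, hcon⟩
  obtain ⟨g1, g2, g3, g4⟩ := hg
  obtain ⟨j, -, hj0, hjp⟩ := ax_exists_simple h g1 g2
  have hjK : j ∈ K := by
    by_contra hj; exact hj0 (g3 j hj)
  have hne : g ≠ α j := fun e => g4 (e ▸ ax_simple_mem α s hjK)
  have m1 : s (α j) g ∈ Delo α s := ax_refl_act h (ax_simple_mem α s (Set.mem_univ j)) g1
  have m2 := ax_refl_simple_pos h (Set.mem_univ j) g1 g2 hne
  have pj := h.Bpos _ (ax_simple_mem α s (Set.mem_univ j))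
  have m3 : s (α j) g ∈ T := by
    refine ⟨m1, m2, fun i hi => ?_, fun hm => ?_⟩
    · have hij : i ≠ j := fun e => hi (e ▸ hjK)
      rw [h.refl_def _ (ax_simple_ne h j)]
      simp [axc_simple, hij, g3 i hi]
    · apply g4
      have := ax_refl_act h (ax_simple_mem α s hjK) hm
      have e : s (α j) (s (α j) g) = g :=
        congrArg (fun g' : V ≃ₗ[ℝ] V => g' g) (ax_refl_sq h (ax_simple_ne h j))
      rwa [e] at this
  have := hmin _ m3
  rw [h.refl_def _ (ax_simple_ne h j), map_sub, map_smul, hH] at this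
  have : 0 < 2 * B g (α j) / B (α j) (α j) := by positivity
  simp at *
  linarith

theorem ax_high_dom (h : AffineSetup α δ θ B s) {J : Set ι} {t : V}
    (ht : t ∈ HighRoots α s J) : ∀ j ∈ J, 0 ≤ B (α j) t := by
  intro j hj
  by_contra hcon
  push Not at hcon
  obtain ⟨h1, h2, h3⟩ := ht
  have hA := ax_simple_mem α s hj
  apply h3 j hj
  have := ax_sub h h1 (ax_neg_mem h hA) (by rw [h.Bsymm]; simpa using hcon) ?_
  · simpa using this
  · intro e
    rw [e] at h2
    exact ax_not_both h hA (ax_simple_pos h j) h2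

theorem ax_high_max (h : AffineSetup α δ θ B s) {J : Set ι} {t g : V}
    (ht : t ∈ HighRoots α s J) (hg : g ∈ DeloJ α s J) (hp : PosoComb α g) :
    t + g ∉ DeloJ α s J := by
  intro hcon
  obtain ⟨H, hH⟩ := ax_ht h
  let T : Set V := {v | v ∈ DeloJ α s J ∧ PosoComb α v ∧ t + v ∈ DeloJ α s J}
  have hT : T.Finite := (ax_J_finite h J).subset fun v hv => hv.1
  obtain ⟨v, ⟨g1, g2, g3⟩, hmin⟩ := Set.exists_min_image T H hT ⟨g, hg, hp, hcon⟩
  obtain ⟨j, hj, -, hjp⟩ := ax_exists_simple h g1 g2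
  have hA := ax_simple_mem α s hj
  have hdom := ax_high_dom h ht j hj
  obtain ⟨h1, h2, h3⟩ := ht
  have hne : v ≠ α j := fun e => h3 j hj (e ▸ g3)
  have m1 := ax_sub h g1 hA hjp hne
  have m2 : PosoComb α (v - α j) := by
    have := ax_sub_simple_pos h (t := 1) g1 g2 hne (by simpa using m1)
    simpa using this
  have m3 : t + (v - α j) ∈ DeloJ α s J := by
    have := ax_sub h g3 hA (by rw [map_add, LinearMap.add_apply, h.Bsymm t]; linarith) ?_
    · rwa [add_sub_assoc] at this
    · intro e
      apply ax_not_both h m1 m2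
      have : -(v - α j) = t := by rw [← e]; abel
      rw [this]; exact h2
  have := hmin _ ⟨m1, m2, m3⟩
  rw [map_sub, hH] at this
  linarith

/-- pairing of a positive root with a highest coroot is 0 or 1, unless equal -/
theorem ax_high_pair (h : AffineSetup α δ θ B s) {J : Set ι} {t e : V} {n : ℤ}
    (ht : t ∈ HighRoots α s J) (he : e ∈ DeloJ α s J) (hp : PosoComb α e) (hne : e ≠ t)
    (hn : 2 * B e t / B t t = n) : n = 0 ∨ n = 1 := by
  have pt := ax_root_pos h ht.1
  have h0 := ax_pair_nonneg h he hp (ax_high_dom h ht)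
  have hn0 : 0 ≤ n := by
    have : (0 : ℝ) ≤ n := by rw [← hn]; positivity
    exact_mod_cast this
  by_contra hcon
  have hn2 : 2 ≤ n := by omega
  have hn2' : (2 : ℝ) ≤ n := by exact_mod_cast hn2
  rw [← hn, le_div_iff₀ pt] at hn2'
  have m1 := ax_sub h ht.1 he (by rw [h.Bsymm]; linarith) hne.symm
  rcases ax_dich h m1 with h1 | h1
  · have h2 := ax_pair_nonneg h m1 h1 (ax_high_dom h ht)
    rw [map_sub, LinearMap.sub_apply] at h2
    have h3 : B e t = B t t := by linarith
    have m2 := ax_refl_act h m1 he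
    apply ax_high_max h ht m1 h1
    rw [h.refl_def _ (ax_root_pos h m1).ne'] at m2
    have h4 : 2 * B e (t - e) / B (t - e) (t - e) = -2 := by
      rw [div_eq_iff (ax_root_pos h m1).ne']
      simp only [map_sub, LinearMap.sub_apply, h.Bsymm t e]
      rw [h3]; ring
    rw [h4] at m2
    convert m2 using 1
    module
  · apply ax_high_max h ht (ax_neg_mem h m1) h1
    simpa using he

end roots2

section affine

variable {α : ι → V} {δ θ : V} {B : V →ₗ[ℝ] V →ₗ[ℝ] ℝ} {s : V → V ≃ₗ[ℝ] V}

/-- Positivity of real roots of `Δ_J`, via the decomposition `mδ + ε`. -/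
def axP (α : ι → V) (δ : V) (s : V → V ≃ₗ[ℝ] V) (J : Set ι) (v : V) : Prop :=
  ∃ m : ℤ, ∃ e ∈ DeloJ α s J, v = (m : ℝ) • δ + e ∧ (0 < m ∨ (m = 0 ∧ PosoComb α e))

theorem ax_delta_orth (h : AffineSetup α δ θ B s) {v : V} (hv : v ∈ Delo α s) : B δ v = 0 := by
  rw [axc_span h hv]
  simp [h.delta_orth]

theorem ax_orth_delta (h : AffineSetup α δ θ B s) {v : V} (hv : v ∈ Delo α s) : B v δ = 0 := by
  rw [h.Bsymm]; exact ax_delta_orth h hv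

theorem ax_decomp_unique (h : AffineSetup α δ θ B s) {x y : ℝ} {u v : V} (hu : u ∈ Delo α s)
    (hv : v ∈ Delo α s) (e : x • δ + u = y • δ + v) : x = y ∧ u = v := by
  obtain ⟨D, h1, -, -, h2⟩ := ax_D h
  have h3 := congrArg D e
  simp [h1, h2 u hu, h2 v hv] at h3
  subst h3
  exact ⟨rfl, add_left_cancel e⟩

theorem axP_not_both (h : AffineSetup α δ θ B s) {J : Set ι} {v : V}
    (h1 : axP α δ s J v) (h2 : axP α δ s J (-v)) : False := by
  obtain ⟨m, e, he, rfl, hm⟩ := h1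
  obtain ⟨m', e', he', hv, hm'⟩ := h2
  have h3 : ((-m : ℤ) : ℝ) • δ + (-e) = (m' : ℝ) • δ + e' := by
    rw [← hv]; push_cast; module
  obtain ⟨h4, h5⟩ := ax_decomp_unique h (ax_DeloJ_sub α s (ax_neg_mem h he))
    (ax_DeloJ_sub α s he') h3
  have h6 : -m = m' := by exact_mod_cast h4
  rcases hm with hm | ⟨hm, hp⟩ <;> rcases hm' with hm' | ⟨hm', hp'⟩ <;> try omega
  exact ax_not_both h he hp (h5 ▸ hp')

theorem axP_of_mem (h : AffineSetup α δ θ B s) {J : Set ι} (m : ℤ) {e : V}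
    (he : e ∈ DeloJ α s J) :
    axP α δ s J ((m : ℝ) • δ + e) ∨ axP α δ s J (-((m : ℝ) • δ + e)) := by
  rcases lt_trichotomy m 0 with hm | hm | hm
  · right
    exact ⟨-m, -e, ax_neg_mem h he, by push_cast; module, Or.inl (by omega)⟩
  · rcases ax_dich h he with hp | hp
    · left; exact ⟨m, e, he, rfl, Or.inr ⟨hm, hp⟩⟩
    · right
      exact ⟨-m, -e, ax_neg_mem h he, by push_cast; module, Or.inr ⟨by omega, hp⟩⟩
  · left; exact ⟨m, e, he, rfl, Or.inl hm⟩

theorem ax_PiJ_ne (h : AffineSetup α δ θ B s) {J : Set ι} {a : V} (ha : a ∈ PiJ α δ s J) :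
    B a a ≠ 0 := by
  rcases ha with ⟨j, hj, rfl⟩ | ⟨t, ht, rfl⟩
  · exact ax_simple_ne h j
  · have := ax_root_pos h ht.1
    have ht' := ax_DeloJ_sub α s ht.1
    simp [ax_delta_orth h ht', ax_orth_delta h ht', h.delta_null]
    exact this.ne'

theorem axP_simple (h : AffineSetup α δ θ B s) {J : Set ι} {a : V} (ha : a ∈ PiJ α δ s J) :
    axP α δ s J a := by
  rcases ha with ⟨j, hj, rfl⟩ | ⟨t, ht, rfl⟩
  · exact ⟨0, α j, ax_simple_mem α s hj, by simp, Or.inr ⟨rfl, ax_simple_pos h j⟩⟩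
  · exact ⟨1, -t, ax_neg_mem h ht.1, by simp [sub_eq_add_neg], Or.inl one_pos⟩

theorem ax_refl_delta_simple (h : AffineSetup α δ θ B s) (j : ι) (m : ℝ) (e : V) :
    s (α j) (m • δ + e) = m • δ + s (α j) e := by
  have : s (α j) δ = δ := by
    rw [h.refl_def _ (ax_simple_ne h j), h.delta_orth]; simp
  rw [map_add, map_smul, this]

theorem ax_refl_affine (h : AffineSetup α δ θ B s) {J : Set ι} {t e : V} {n : ℤ} (m : ℝ)
    (ht : t ∈ HighRoots α s J) (he : e ∈ DeloJ α s J) (hn : 2 * B e t / B t t = n) :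
    s (δ - t) (m • δ + e) = (m + n) • δ + s t e := by
  have ht' := ax_DeloJ_sub α s ht.1
  have he' := ax_DeloJ_sub α s he
  have hne := ax_PiJ_ne h (Or.inr ⟨t, ht, rfl⟩ : δ - t ∈ PiJ α δ s J)
  rw [h.refl_def _ hne, ax_refl_int h ht.1 hn]
  have h1 : B (m • δ + e) (δ - t) = - B e t := by
    simp [ax_delta_orth h ht', ax_orth_delta h he', h.delta_null]
  have h2 : B (δ - t) (δ - t) = B t t := by
    simp [ax_delta_orth h ht', ax_orth_delta h ht', h.delta_null]
  rw [h1, h2]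
  have h3 : 2 * -B e t / B t t = -n := by rw [← hn]; ring
  rw [h3]
  module

theorem axP_refl (h : AffineSetup α δ θ B s) {J : Set ι} {a v : V} (ha : a ∈ PiJ α δ s J)
    (hv : axP α δ s J v) (hne : v ≠ a) : axP α δ s J (s a v) := by
  obtain ⟨m, e, he, rfl, hm⟩ := hv
  rcases ha with ⟨j, hj, rfl⟩ | ⟨t, ht, rfl⟩
  · refine ⟨m, s (α j) e, ax_refl_act h (ax_simple_mem α s hj) he, ax_refl_delta_simple h j _ _, ?_⟩
    rcases hm with hm | ⟨rfl, hp⟩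
    · exact Or.inl hm
    · exact Or.inr ⟨rfl, ax_refl_simple_pos h hj he hp (by simpa using hne)⟩
  · obtain ⟨n, hn⟩ := ax_int h ht.1 he
    have pt := ax_root_pos h ht.1
    refine ⟨m + n, s t e, ax_refl_act h ht.1 he, ?_, ?_⟩
    · push_cast; exact ax_refl_affine h m ht he hn
    rcases ax_dich h he with hp | hp
    · have hm0 : 0 ≤ m := by omega
      by_cases het : e = t
      · subst het
        have : n = 2 := by
          have : (n : ℝ) = 2 := by rw [← hn]; field_simp
          exact_mod_cast this
        left; omega
      · rcases ax_high_pair h ht he hp het hn with rfl | rfl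
        · rcases hm with hm | ⟨rfl, _⟩
          · left; omega
          · right
            refine ⟨by simp, ?_⟩
            rw [ax_refl_int h ht.1 hn]; simpa using hp
        · left; omega
    · have hm1 : 0 < m := by
        rcases hm with hm | ⟨_, hp'⟩
        · exact hm
        · exact (ax_not_both h he hp' hp).elim
      have hen := ax_neg_mem h he
      have hn' : 2 * B (-e) t / B t t = ((-n : ℤ) : ℝ) := by
        push_cast; rw [← hn]; simp; ring
      by_cases het : -e = t
      · have e1 : e = -t := by rw [← het, neg_neg]
        subst e1
        have : n = -2 := by
          have : (n : ℝ) = -2 := by rw [← hn]; simp; field_simp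
          exact_mod_cast this
        have hm2 : m ≠ 1 := by
          rintro rfl
          apply hne
          simp [sub_eq_add_neg]
        rcases (show 2 < m ∨ m = 2 by omega) with h2 | h2
        · left; omega
        · right
          refine ⟨by omega, ?_⟩
          rw [map_neg, ax_refl_self h pt.ne', neg_neg]
          exact ht.2.1
      · rcases ax_high_pair h ht hen hp het hn' with h0 | h0
        · left; omega
        · rcases (show 1 < m ∨ m = 1 by omega) with h2 | h2
          · left; omega
          · right
            refine ⟨by omega, ?_⟩
            have hst : s t e = e + t := by
              rw [ax_refl_int h ht.1 hn, show n = -1 by omega]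
              simp
            have hmem := ax_refl_act h ht.1 he
            rw [hst] at hmem ⊢
            rcases ax_dich h hmem with h3 | h3
            · exact h3
            · exfalso
              apply ax_high_max h ht (ax_neg_mem h hmem) h3
              convert hen using 1
              abel

/-- real roots of `Δ_J` are stable under simple reflections -/
theorem ax_R_refl (h : AffineSetup α δ θ B s) {J : Set ι} {a v : V} (ha : a ∈ PiJ α δ s J)
    (hv : v ∈ DelReJ α δ s J) : s a v ∈ DelReJ α δ s J := by
  obtain ⟨m, e, he, rfl⟩ := hv
  rw [← Int.cast_smul_eq_zsmul ℝ]
  rcases ha with ⟨j, hj, rfl⟩ | ⟨t, ht, rfl⟩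
  · refine ⟨m, s (α j) e, ax_refl_act h (ax_simple_mem α s hj) he, ?_⟩
    rw [← Int.cast_smul_eq_zsmul ℝ]
    exact ax_refl_delta_simple h j _ _
  · obtain ⟨n, hn⟩ := ax_int h ht.1 he
    refine ⟨m + n, s t e, ax_refl_act h ht.1 he, ?_⟩
    rw [← Int.cast_smul_eq_zsmul ℝ]
    push_cast; exact ax_refl_affine h m ht he hn

theorem ax_inv_refl (h : AffineSetup α δ θ B s) {J : Set ι} {a : V} (ha : a ∈ PiJ α δ s J) :
    (s a)⁻¹ = s a :=
  inv_eq_of_mul_eq_one_left (ax_refl_sq h (ax_PiJ_ne h ha))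

theorem ax_WJ_R (h : AffineSetup α δ θ B s) {J : Set ι} {g : V ≃ₗ[ℝ] V}
    (hg : g ∈ WJ α δ s J) : (∀ v ∈ DelReJ α δ s J, g v ∈ DelReJ α δ s J) ∧
      (∀ v ∈ DelReJ α δ s J, g⁻¹ v ∈ DelReJ α δ s J) := by
  induction hg using Subgroup.closure_induction with
  | mem x hx =>
    obtain ⟨a, ha, rfl⟩ := hx
    rw [ax_inv_refl h ha]
    exact ⟨fun v hv => ax_R_refl h ha hv, fun v hv => ax_R_refl h ha hv⟩
  | one => simp
  | mul x y _ _ hx hy =>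
    rw [mul_inv_rev]
    exact ⟨fun v hv => hx.1 _ (hy.1 v hv), fun v hv => hy.2 _ (hx.2 v hv)⟩
  | inv x _ hx => rw [inv_inv]; exact hx.symm

theorem ax_WJ_inv (h : AffineSetup α δ θ B s) {J : Set ι} {g : V ≃ₗ[ℝ] V}
    (hg : g ∈ WJ α δ s J) : ∀ u v, B (g u) (g v) = B u v := by
  induction hg using Subgroup.closure_induction with
  | mem x hx =>
    obtain ⟨a, ha, rfl⟩ := hx
    exact fun u v => ax_refl_inv h (ax_PiJ_ne h ha) u v
  | one => intro u v; rfl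
  | mul x y _ _ hx hy => intro u v; exact (hx _ _).trans (hy _ _)
  | inv x _ hx =>
    intro u v
    rw [← hx (x⁻¹ u) (x⁻¹ v)]
    change B (x (x.symm u)) (x (x.symm v)) = _
    simp

theorem axP_R {J : Set ι} {v : V} (hv : axP α δ s J v) : v ∈ DelReJ α δ s J := by
  obtain ⟨m, e, he, rfl, -⟩ := hv
  exact ⟨m, e, he, by rw [Int.cast_smul_eq_zsmul]⟩

theorem axP_dich (h : AffineSetup α δ θ B s) {J : Set ι} {v : V} (hv : v ∈ DelReJ α δ s J) :
    axP α δ s J v ∨ axP α δ s J (-v) := by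
  obtain ⟨m, e, he, rfl⟩ := hv
  rw [← Int.cast_smul_eq_zsmul ℝ]
  exact axP_of_mem h m he

theorem axP_of_PosComb (h : AffineSetup α δ θ B s) {J : Set ι} {v : V}
    (hv : v ∈ DelReJ α δ s J) (hp : PosComb α δ θ v) : axP α δ s J v := by
  obtain ⟨m, e, he, rfl⟩ := hv
  rw [← Int.cast_smul_eq_zsmul ℝ] at hp ⊢
  obtain ⟨D, h1, h1', h1'', h2⟩ := ax_D h
  obtain ⟨c, hc, hce⟩ := hp
  rw [Fintype.sum_option] at hce
  simp only [alHat, Option.elim_none, Option.elim_some] at hce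
  have h3 := congrArg D hce
  simp [h1, h1'', h2 e (ax_DeloJ_sub α s he), h2 θ h.theta_high.1] at h3
  have hm : 0 ≤ m := by
    have : (0 : ℝ) ≤ m := h3 ▸ hc none
    exact_mod_cast this
  refine ⟨m, e, he, rfl, ?_⟩
  rcases hm.lt_or_eq with hm | hm
  · exact Or.inl hm
  · right
    refine ⟨hm.symm, fun i => c (some i), fun i => hc _, ?_⟩
    rw [← h3, ← hm] at hce
    simpa using hce

theorem ax_PosComb (h : AffineSetup α δ θ B s) {M : ℝ} (hM : 0 ≤ M) {e : V}
    (hp : PosoComb α e) : PosComb α δ θ (M • δ + e) := by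
  obtain ⟨c, hc, rfl⟩ := hp
  obtain ⟨d, hd, hdt⟩ := h.theta_high.2.1
  refine ⟨fun o => o.elim M (fun i => M * d i + c i), ?_, ?_⟩
  · rintro (_ | i)
    · exact hM
    · have := hd i; have := hc i
      simp only [Option.elim_some]; positivity
  · rw [Fintype.sum_option]
    simp only [alHat, Option.elim_none, Option.elim_some, add_smul, mul_smul,
      Finset.sum_add_distrib, ← Finset.smul_sum]
    rw [← hdt]
    module

end affine

section words

variable {α : ι → V} {δ θ : V} {B : V →ₗ[ℝ] V →ₗ[ℝ] ℝ} {s : V → V ≃ₗ[ℝ] V}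

theorem ax_word_mem {J : Set ι} {l : List V} (hl : ∀ a ∈ l, a ∈ PiJ α δ s J) :
    (l.map s).prod ∈ WJ α δ s J := by
  refine Subgroup.list_prod_mem _ fun x hx => ?_
  obtain ⟨a, ha, rfl⟩ := List.mem_map.1 hx
  exact Subgroup.subset_closure ⟨a, hl a ha, rfl⟩

theorem ax_exchange (h : AffineSetup α δ θ B s) {J : Set ι} {a : V} (ha : a ∈ PiJ α δ s J)
    (l : List V) (hl : ∀ a ∈ l, a ∈ PiJ α δ s J) (hn : axP α δ s J (-((l.map s).prod a))) :
    ∃ l' : List V, (∀ a ∈ l', a ∈ PiJ α δ s J) ∧ l'.length + 1 = l.length ∧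
      (l'.map s).prod = (l.map s).prod * s a := by
  induction l with
  | nil =>
    exfalso
    exact axP_not_both h (axP_simple h ha) (by simpa using hn)
  | cons b t ih =>
    have hb := hl b (by simp)
    have htl : ∀ a ∈ t, a ∈ PiJ α δ s J := fun x hx => hl x (by simp [hx])
    have htm := ax_word_mem htl
    rcases axP_dich h ((ax_WJ_R h htm).1 a (axP_R (axP_simple h ha))) with hP | hP
    · have heq : (t.map s).prod a = b := by
        by_contra hne
        refine axP_not_both h (axP_refl h hb hP hne) ?_
        simpa using hn
      have := ax_conj h (ax_PiJ_ne h ha) (ax_WJ_inv h htm) heq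
      refine ⟨t, htl, by simp, ?_⟩
      rw [List.map_cons, List.prod_cons, ← this, mul_assoc, ax_refl_sq h (ax_PiJ_ne h ha), mul_one]
    · obtain ⟨l', h1, h2, h3⟩ := ih htl hP
      refine ⟨b :: l', ?_, by simp [h2], by simp [h3, mul_assoc]⟩
      intro x hx
      rcases List.mem_cons.1 hx with rfl | hx
      · exact hb
      · exact h1 x hx

theorem ax_len_le {J : Set ι} {l : List V} (hl : ∀ a ∈ l, a ∈ PiJ α δ s J) :
    lenG (SJ α δ s J) (l.map s).prod ≤ l.length := by
  refine Nat.sInf_le ⟨l.map s, ?_, by simp, rfl⟩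
  intro x hx
  obtain ⟨a, ha, rfl⟩ := List.mem_map.1 hx
  exact ⟨a, hl a ha, rfl⟩

theorem ax_len_word {J : Set ι} {l : List V} (hl : ∀ a ∈ l, a ∈ PiJ α δ s J) :
    ∃ l' : List V, (∀ a ∈ l', a ∈ PiJ α δ s J) ∧
      l'.length = lenG (SJ α δ s J) (l.map s).prod ∧ (l'.map s).prod = (l.map s).prod := by
  have : lenG (SJ α δ s J) (l.map s).prod ∈ {n | ∃ l' : List (V ≃ₗ[ℝ] V),
      (∀ x ∈ l', x ∈ SJ α δ s J) ∧ l'.length = n ∧ l'.prod = (l.map s).prod} := by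
    refine Nat.sInf_mem ⟨l.length, l.map s, ?_, by simp, rfl⟩
    intro x hx
    obtain ⟨a, ha, rfl⟩ := List.mem_map.1 hx
    exact ⟨a, hl a ha, rfl⟩
  obtain ⟨L, h1, h2, h3⟩ := this
  have key : ∀ L : List (V ≃ₗ[ℝ] V), (∀ x ∈ L, x ∈ SJ α δ s J) →
      ∃ l' : List V, (∀ a ∈ l', a ∈ PiJ α δ s J) ∧ l'.map s = L := by
    intro L
    induction L with
    | nil => intro _; exact ⟨[], by simp, rfl⟩
    | cons x L ih =>
      intro hL
      obtain ⟨l', h1, h2⟩ := ih fun y hy => hL y (by simp [hy])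
      obtain ⟨a, ha, hax⟩ := hL x (by simp)
      refine ⟨a :: l', ?_, by simp [hax, h2]⟩
      intro y hy
      rcases List.mem_cons.1 hy with rfl | hy
      · exact ha
      · exact h1 y hy
  obtain ⟨l', h4, rfl⟩ := key L h1
  exact ⟨l', h4, by simpa using h2, h3⟩

theorem ax_len_succ (h : AffineSetup α δ θ B s) {J : Set ι} {a : V} (ha : a ∈ PiJ α δ s J)
    {l : List V} (hl : ∀ a ∈ l, a ∈ PiJ α δ s J) (hp : axP α δ s J ((l.map s).prod a)) :
    lenG (SJ α δ s J) (l.map s).prod + 1 ≤ lenG (SJ α δ s J) ((l.map s).prod * s a) := by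
  have hl2 : ∀ x ∈ l ++ [a], x ∈ PiJ α δ s J := by
    intro x hx
    rcases List.mem_append.1 hx with hx | hx
    · exact hl x hx
    · rw [List.mem_singleton.1 hx]; exact ha
  obtain ⟨l0, h1, h2, h3⟩ := ax_len_word hl2
  have e : ((l ++ [a]).map s).prod = (l.map s).prod * s a := by simp
  rw [e] at h2 h3
  have hne := ax_PiJ_ne h ha
  obtain ⟨l', h4, h5, h6⟩ := ax_exchange h ha l0 h1 (by
    rw [h3]
    change axP α δ s J (-((l.map s).prod (s a a)))
    rw [ax_refl_self h hne, map_neg, neg_neg]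
    exact hp)
  rw [h3, mul_assoc, ax_refl_sq h hne, mul_one] at h6
  rw [← h2, ← h5, ← h6]
  have := ax_len_le h4
  omega

theorem ax_rev (h : AffineSetup α δ θ B s) {J : Set ι}
    {l : List V} (hl : ∀ a ∈ l, a ∈ PiJ α δ s J) :
    (l.reverse.map s).prod = ((l.map s).prod)⁻¹ := by
  induction l with
  | nil => simp
  | cons b t ih =>
    have hb := hl b (by simp)
    have ih' := ih fun x hx => hl x (by simp [hx])
    rw [List.reverse_cons, List.map_append, List.prod_append, ih']
    simp [ax_inv_refl h hb]

/-- for a minimal word, both prefix and suffix roots are positive -/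
theorem ax_min_word (h : AffineSetup α δ θ B s) {J : Set ι} {a : V} {l1 l2 : List V}
    (hl : ∀ x ∈ l1 ++ a :: l2, x ∈ PiJ α δ s J)
    (hmin : (l1 ++ a :: l2).length = lenG (SJ α δ s J) ((l1 ++ a :: l2).map s).prod) :
    axP α δ s J ((l1.map s).prod a) ∧ axP α δ s J (((l2.map s).prod)⁻¹ a) := by
  have ha := hl a (by simp)
  have hl1 : ∀ x ∈ l1, x ∈ PiJ α δ s J := fun x hx => hl x (by simp [hx])
  have hl2 : ∀ x ∈ l2, x ∈ PiJ α δ s J := fun x hx => hl x (by simp [hx])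
  have hl2' : ∀ x ∈ l2.reverse, x ∈ PiJ α δ s J := fun x hx => hl2 x (by simpa using hx)
  have haR := axP_R (axP_simple h ha)
  constructor
  · rcases axP_dich h ((ax_WJ_R h (ax_word_mem hl1)).1 a haR) with hP | hP
    · exact hP
    · exfalso
      obtain ⟨l', h1, h2, h3⟩ := ax_exchange h ha l1 hl1 hP
      have hw : ∀ x ∈ l' ++ l2, x ∈ PiJ α δ s J := by
        intro x hx
        rcases List.mem_append.1 hx with hx | hx
        · exact h1 x hx
        · exact hl2 x hx
      have := ax_len_le hw
      have e : ((l' ++ l2).map s).prod = ((l1 ++ a :: l2).map s).prod := by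
        simp [h3, mul_assoc]
      rw [e, ← hmin] at this
      simp at this
      omega
  · rw [← ax_rev h hl2]
    rcases axP_dich h ((ax_WJ_R h (ax_word_mem hl2')).1 a haR) with hP | hP
    · exact hP
    · exfalso
      obtain ⟨l', h1, h2, h3⟩ := ax_exchange h ha l2.reverse hl2' hP
      have h1' : ∀ x ∈ l'.reverse, x ∈ PiJ α δ s J := fun x hx => h1 x (by simpa using hx)
      have hw : ∀ x ∈ l1 ++ l'.reverse, x ∈ PiJ α δ s J := by
        intro x hx
        rcases List.mem_append.1 hx with hx | hx
        · exact hl1 x hx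
        · exact h1' x hx
      have := ax_len_le hw
      have e : ((l1 ++ l'.reverse).map s).prod = ((l1 ++ a :: l2).map s).prod := by
        rw [List.map_append, List.prod_append, ax_rev h h1, h3, ax_rev h hl2]
        simp [ax_inv_refl h ha]
      rw [e, ← hmin] at this
      simp at this h2
      omega

end words

section transl

variable {α : ι → V} {δ θ : V} {B : V →ₗ[ℝ] V →ₗ[ℝ] ℝ} {s : V → V ≃ₗ[ℝ] V}

theorem axP_shift (h : AffineSetup α δ θ B s) {J : Set ι} {v : V} {x : ℝ} (hx : 0 ≤ x)
    (hv : axP α δ s J v) (hn : axP α δ s J (-(v + x • δ))) : False := by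
  obtain ⟨m, e, he, rfl, hm⟩ := hv
  obtain ⟨m', e', he', hv, hm'⟩ := hn
  have h3 : (-m - x) • δ + (-e) = (m' : ℝ) • δ + e' := by
    rw [← hv]; module
  obtain ⟨h4, h5⟩ := ax_decomp_unique h (ax_DeloJ_sub α s (ax_neg_mem h he))
    (ax_DeloJ_sub α s he') h3
  have hm0 : 0 ≤ m := by omega
  have hm0' : 0 ≤ m' := by omega
  have r1 : (0 : ℝ) ≤ m := by exact_mod_cast hm0
  have r2 : (0 : ℝ) ≤ m' := by exact_mod_cast hm0'
  have e1 : m = 0 := by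
    have : (m : ℝ) = 0 := by linarith
    exact_mod_cast this
  have e2 : m' = 0 := by
    have : (m' : ℝ) = 0 := by linarith
    exact_mod_cast this
  rcases hm with hm | ⟨_, hp⟩
  · omega
  rcases hm' with hm' | ⟨_, hp'⟩
  · omega
  exact ax_not_both h he hp (h5 ▸ hp')

theorem ax_simple_in_span (α : ι → V) (δ θ : V) (i : ι) :
    α i ∈ Submodule.span ℝ (Set.range (alHat α δ θ)) :=
  Submodule.subset_span ⟨some i, rfl⟩

theorem ax_root_in_span (h : AffineSetup α δ θ B s) {v : V} (hv : v ∈ Delo α s) :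
    v ∈ Submodule.span ℝ (Set.range (alHat α δ θ)) := by
  rw [axc_span h hv]
  exact Submodule.sum_mem _ fun i _ => Submodule.smul_mem _ _ (ax_simple_in_span α δ θ i)

theorem ax_delta_in_span (h : AffineSetup α δ θ B s) :
    δ ∈ Submodule.span ℝ (Set.range (alHat α δ θ)) := by
  have h1 : δ - θ ∈ Submodule.span ℝ (Set.range (alHat α δ θ)) :=
    Submodule.subset_span ⟨none, rfl⟩
  have := Submodule.add_mem _ h1 (ax_root_in_span h h.theta_high.1)
  simpa using this

theorem ax_R_in_span (h : AffineSetup α δ θ B s) {J : Set ι} {v : V} (hv : v ∈ DelReJ α δ s J) :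
    v ∈ Submodule.span ℝ (Set.range (alHat α δ θ)) := by
  obtain ⟨m, e, he, rfl⟩ := hv
  rw [← Int.cast_smul_eq_zsmul ℝ]
  exact Submodule.add_mem _ (Submodule.smul_mem _ _ (ax_delta_in_span h))
    (ax_root_in_span h (ax_DeloJ_sub α s he))

theorem ax_delta_lam (h : AffineSetup α δ θ B s) {J : Set ι} {lam : V} (hlam : lam ∈ QJ α B J) :
    B δ lam = 0 := by
  obtain ⟨c, -, rfl⟩ := hlam
  simp [coroot, h.delta_orth]

theorem ax_transl_pow (h : AffineSetup α δ θ B s) {lam : V} (hd : B δ lam = 0)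
    {g : V ≃ₗ[ℝ] V} (hg : IsTransl α δ θ B lam g) (k : ℕ) {v : V}
    (hv : v ∈ Submodule.span ℝ (Set.range (alHat α δ θ))) :
    (g ^ k) v = v - (k * B v lam) • δ := by
  induction k with
  | zero => simp
  | succ k ih =>
    rw [pow_succ']
    change g ((g ^ k) v) = _
    have hδ : g δ = δ := by rw [hg δ (ax_delta_in_span h), hd]; simp
    rw [ih, map_sub, map_smul, hδ, hg v hv]
    push_cast
    module

theorem ax_transl_inv_pow (h : AffineSetup α δ θ B s) {lam : V} (hd : B δ lam = 0)
    {g : V ≃ₗ[ℝ] V} (hg : IsTransl α δ θ B lam g) (k : ℕ) {v : V}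
    (hv : v ∈ Submodule.span ℝ (Set.range (alHat α δ θ))) :
    (g ^ k)⁻¹ v = v + (k * B v lam) • δ := by
  have h1 : v + (k * B v lam) • δ ∈ Submodule.span ℝ (Set.range (alHat α δ θ)) :=
    Submodule.add_mem _ hv (Submodule.smul_mem _ _ (ax_delta_in_span h))
  have h2 := ax_transl_pow h hd hg k h1
  have h3 : (g ^ k) (v + (k * B v lam) • δ) = v := by
    rw [h2]; simp [hd]
  change (g ^ k).symm v = _
  rw [LinearEquiv.symm_apply_eq, h3]

end transl

/-- Proposition 7.1: let `K ⊊ J`, and let `λ ∈ ∘Q^∨_J` satisfy `(α_j|λ) > 0` for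
`j ∈ J ∖ K` and `(α_k|λ) = 0` for `k ∈ K`. If `t_λ = s(1)⋯s(n)` is a reduced expression in
`(W_J, S_J)` and `s` is extended periodically, then the resulting infinite sequence is an
infinite reduced word of `(W_J, S_J)` with `⋃_p Φ_J(s(1)⋯s(p)) = Δ^K_J(1, −)`. -/
theorem statement18 (α : ι → V) (δ θ : V) (B : V →ₗ[ℝ] V →ₗ[ℝ] ℝ) (s : V → V ≃ₗ[ℝ] V)
    (h : AffineSetup α δ θ B s) (J K : Set ι) (hK : K ⊂ J) (lam : V)
    (hlam : lam ∈ QJ α B J)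
    (hpos : ∀ j ∈ J, j ∉ K → 0 < B (α j) lam) (hzero : ∀ k ∈ K, B (α k) lam = 0)
    (tl : V ≃ₗ[ℝ] V) (htl : tl ∈ WJ α δ s J) (htrans : IsTransl α δ θ B lam tl)
    (l : List V) (hl : ∀ a ∈ l, a ∈ PiJ α δ s J) (hprod : (l.map s).prod = tl)
    (hred : l.length = lenG (SJ α δ s J) tl)
    (seq : ℕ → V) (hseq : ∀ p : ℕ, seq p = l.getD (p % l.length) 0) :
    (∀ p : ℕ, lenG (SJ α δ s J) (((List.range p).map fun k => s (seq k)).prod) = p) ∧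
      (⋃ p : ℕ, PhiJb α δ θ s J (((List.range p).map fun k => s (seq k)).prod)) =
        DKJm α δ θ s J K 1 := by
  classical
  have hd := ax_delta_lam h hlam
  obtain ⟨D, hD1, -, -, hD2⟩ := ax_D h
  have hδ0 : δ ≠ 0 := by rintro rfl; simp at hD1
  have hn : 0 < l.length := by
    rw [List.length_pos_iff]
    rintro rfl
    obtain ⟨j, hj, hjK⟩ := Set.exists_of_ssubset hK
    have h1 := htrans (α j) (ax_simple_in_span α δ θ j)
    rw [← hprod] at h1
    have h2 : B (α j) lam • δ = 0 := sub_eq_self.1 h1.symm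
    rcases smul_eq_zero.1 h2 with h3 | h3
    · exact (hpos j hj hjK).ne' h3
    · exact hδ0 h3
  set n := l.length with hnl
  have hseqlt : ∀ r (hr : r < l.length), seq r = l[r] := by
    intro r hr
    rw [hseq, Nat.mod_eq_of_lt hr]
    simp [hr]
  have hseqper : ∀ q, seq (n + q) = seq q := by
    intro q; rw [hseq, hseq]; simp
  have hseqmem : ∀ p, seq p ∈ PiJ α δ s J := by
    intro p
    have hlt : p % n < l.length := Nat.mod_lt _ hn
    have : seq p = l[p % n] := by rw [hseq]; simp [hlt]
    rw [this]
    exact hl _ (List.getElem_mem _)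
  set pre : ℕ → (V ≃ₗ[ℝ] V) := fun p => ((List.range p).map fun k => s (seq k)).prod with hpre
  have hpre0 : pre 0 = 1 := by simp [hpre]
  have hpreS : ∀ p, pre (p + 1) = pre p * s (seq p) := by
    intro p; simp [hpre, List.range_succ]
  have hpreW : ∀ p, pre p = (((List.range p).map seq).map s).prod := by
    intro p; simp [hpre, Function.comp_def]
  have hwmem : ∀ p, ∀ a ∈ (List.range p).map seq, a ∈ PiJ α δ s J := by
    intro p a ha
    obtain ⟨k, -, rfl⟩ := List.mem_map.1 ha
    exact hseqmem k
  have hpreM : ∀ p, pre p ∈ WJ α δ s J := fun p => by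
    rw [hpreW]; exact ax_word_mem (hwmem p)
  have hpretake : ∀ r, r ≤ l.length → pre r = ((l.take r).map s).prod := by
    intro r
    induction r with
    | zero => intro _; simp [hpre0]
    | succ r ih =>
      intro hr
      rw [hpreS, ih (by omega), hseqlt r (by omega), List.take_add_one]
      simp [show r < l.length by omega]
  have hpren : pre n = tl := by
    rw [hpretake n le_rfl, hnl, List.take_length, hprod]
  have hpreadd : ∀ q, pre (n + q) = tl * pre q := by
    intro q
    induction q with
    | zero => simp [hpre0, hpren]
    | succ q ih => rw [← add_assoc, hpreS, ih, hseqper, hpreS, mul_assoc]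
  have hprek : ∀ k q, pre (k * n + q) = tl ^ k * pre q := by
    intro k q
    induction k with
    | zero => simp
    | succ k ih =>
      rw [show (k + 1) * n + q = n + (k * n + q) by ring, hpreadd, ih, pow_succ', mul_assoc]
  have htk : ∀ k : ℕ, tl ^ k ∈ WJ α δ s J := fun k => Subgroup.pow_mem _ htl k
  -- the roots attached to the first period
  have hbase : ∀ r, r < l.length → axP α δ s J (pre r (seq r)) ∧ B (pre r (seq r)) lam < 0 := by
    intro r hr
    have hsplit : l = l.take r ++ l[r] :: l.drop (r + 1) := by simp
    have hl' : ∀ x ∈ l.take r ++ l[r] :: l.drop (r + 1), x ∈ PiJ α δ s J := by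
      rw [← hsplit]; exact hl
    have hmin := ax_min_word h hl' (by rw [← hsplit, hprod]; exact hred)
    rw [hpretake r hr.le, hseqlt r hr]
    refine ⟨hmin.1, ?_⟩
    by_contra hcon
    push Not at hcon
    set v := ((l.take r).map s).prod l[r] with hv
    have hR := axP_R hmin.1
    have h1 := ax_transl_inv_pow h hd htrans 1 (ax_R_in_span h hR)
    refine axP_shift h hcon hmin.1 ?_
    have h2 : tl⁻¹ v = -((((l.drop (r + 1)).map s).prod)⁻¹ l[r]) := by
      have ha := hl l[r] (List.getElem_mem _)
      have : tl = ((l.take r).map s).prod * (s l[r] * ((l.drop (r + 1)).map s).prod) := by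
        rw [← hprod]
        conv_lhs => rw [hsplit]
        rw [List.map_append, List.prod_append, List.map_cons, List.prod_cons]
      rw [this, mul_inv_rev, mul_inv_rev, ax_inv_refl h ha]
      change (((l.drop (r + 1)).map s).prod)⁻¹ (s l[r]
        (((l.take r).map s).prod.symm (((l.take r).map s).prod l[r]))) = _
      rw [LinearEquiv.symm_apply_apply, ax_refl_self h (ax_PiJ_ne h ha), map_neg]
    simp only [pow_one, Nat.cast_one, one_mul] at h1
    rw [← h1, h2, neg_neg]
    exact hmin.2
  have hall : ∀ p, axP α δ s J (pre p (seq p)) ∧ B (pre p (seq p)) lam < 0 := by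
    intro p
    have hp : p / n * n + p % n = p := Nat.div_add_mod' p n
    obtain ⟨h1, h2⟩ := hbase (p % n) (Nat.mod_lt _ hn)
    have hs : seq p = seq (p % n) := by rw [hseq, hseq]; simp [hnl]
    have e : pre p (seq p) = (tl ^ (p / n)) (pre (p % n) (seq (p % n))) := by
      have e0 : pre p = tl ^ (p / n) * pre (p % n) := by rw [← hprek, hp]
      rw [hs, e0]
      rfl
    rw [e]
    set v := pre (p % n) (seq (p % n))
    set k := p / n
    have hR := axP_R h1
    have hR' := (ax_WJ_R h (htk k)).1 _ hR
    have h3 := ax_transl_pow h hd htrans k (ax_R_in_span h hR)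
    constructor
    · rcases axP_dich h hR' with h4 | h4
      · exact h4
      · exfalso
        refine axP_shift h (x := -(k * B v lam)) ?_ h1 ?_
        · have : (0 : ℝ) ≤ k := Nat.cast_nonneg k
          nlinarith
        · convert h4 using 2
          rw [h3]; module
    · rw [h3]; simpa [hd] using h2
  refine ⟨?_, ?_⟩
  · intro p
    change lenG (SJ α δ s J) (pre p) = p
    apply le_antisymm
    · rw [hpreW]
      have := ax_len_le (hwmem p)
      simpa using this
    · induction p with
      | zero => omega
      | succ p ih =>
        have h1 := ax_len_succ h (hseqmem p) (hwmem p) (by rw [← hpreW]; exact (hall p).1)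
        rw [← hpreW, ← hpreS] at h1
        omega
  · have hdom : ∀ j ∈ J, 0 ≤ B (α j) lam := by
      intro j hj
      by_cases hjK : j ∈ K
      · exact (hzero j hjK).ge
      · exact (hpos j hj hjK).le
    ext β
    simp only [Set.mem_iUnion]
    change (∃ p, β ∈ PhiJb α δ θ s J (pre p)) ↔ _
    constructor
    · rintro ⟨p, hβ, hneg⟩
      obtain ⟨hnD, hnP⟩ := hneg
      rcases hβ with hβ | hβ
      · simp only [brSet, Set.mem_iUnion] at hβ
        obtain ⟨e, he, hb⟩ := hβ
        obtain ⟨⟨m, hm⟩, hre, hdel, hpc⟩ := id hb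
        have hR : β ∈ DelReJ α δ s J := ⟨m, e, he, hm⟩
        have hPβ := axP_of_PosComb h hR hpc
        have hRneg : ∀ v ∈ DelReJ α δ s J, -v ∈ DelReJ α δ s J := by
          rintro v ⟨m, e, he, rfl⟩
          exact ⟨-m, -e, ax_neg_mem h he, by rw [neg_smul]; abel⟩
        have hPn := axP_of_PosComb h (hRneg _ ((ax_WJ_R h (hpreM p)).2 _ hR)) hnP
        have hfind : ∀ p, axP α δ s J (-((pre p)⁻¹ β)) → ∃ i, β = pre i (seq i) := by
          intro p
          induction p with
          | zero =>
            intro hc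
            rw [hpre0] at hc
            exact (axP_not_both h hPβ (by simpa using hc)).elim
          | succ p ih =>
            intro hc
            rcases axP_dich h ((ax_WJ_R h (hpreM p)).2 _ hR) with h1 | h1
            · refine ⟨p, ?_⟩
              by_cases h2 : (pre p)⁻¹ β = seq p
              · rw [← h2]
                change β = pre p ((pre p).symm β)
                simp
              · exfalso
                refine axP_not_both h (axP_refl h (hseqmem p) h1 h2) ?_
                rw [hpreS, mul_inv_rev, ax_inv_refl h (hseqmem p)] at hc
                exact hc
            · exact ih h1
        obtain ⟨i, hi⟩ := hfind p hPn
        have hlt := (hall i).2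
        rw [← hi, hm] at hlt
        have hlt' : B e lam < 0 := by simpa [hd] using hlt
        simp only [DKJm, brSet, Set.mem_iUnion]
        refine ⟨e, ⟨e, ⟨⟨he, fun heK => ?_⟩, ?_⟩, rfl⟩, hb⟩
        · have : B e lam = 0 := by
            rw [axc_span h heK]
            simp only [map_sum, map_smul, LinearMap.sum_apply, LinearMap.smul_apply, smul_eq_mul]
            refine Finset.sum_eq_zero fun k _ => ?_
            by_cases hk : k ∈ K
            · simp [hzero k hk]
            · simp [axc_supp h heK hk]
          linarith
        · rcases ax_dich h he with h1 | h1
          · have := ax_pair_nonneg h he h1 hdom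
            linarith
          · exact h1
      · exfalso
        obtain ⟨m, hm0, rfl⟩ := hβ
        -- imaginary roots are fixed by the group
        have hfix : ∀ p, (pre p) δ = δ := by
          intro p
          have hW := ax_WJ_inv h (hpreM p)
          induction p with
          | zero => simp [hpre0]
          | succ p ih =>
            rw [hpreS]
            change pre p (s (seq p) δ) = δ
            have hz : B δ (seq p) = 0 := by
              rcases hseqmem p with ⟨j, hj, hj'⟩ | ⟨t, ht, ht'⟩
              · rw [← hj']; exact h.delta_orth j
              · rw [← ht']
                simp [h.delta_null, ax_delta_orth h (ax_DeloJ_sub α s ht.1)]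
            rw [h.refl_def _ (ax_PiJ_ne h (hseqmem p)), hz]
            simpa using ih (ax_WJ_inv h (hpreM p))
        have hfix' : (pre p)⁻¹ δ = δ := by
          change (pre p).symm δ = δ
          rw [LinearEquiv.symm_apply_eq, hfix]
        obtain ⟨D, h1, h1', h1'', h2⟩ := ax_D h
        obtain ⟨c, hc, hce⟩ := hnP
        rw [Fintype.sum_option] at hce
        simp only [alHat, Option.elim_none, Option.elim_some] at hce
        have h3 := congrArg D hce
        rw [map_zsmul, hfix'] at h3
        simp [h1, h1'', h2 θ h.theta_high.1] at h3
        have := hc none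
        have : (0 : ℝ) < m := by exact_mod_cast hm0
        linarith
    · intro hβ
      simp only [DKJm, brSet, Set.mem_iUnion] at hβ
      obtain ⟨_, ⟨e, ⟨⟨he, heK⟩, hen⟩, rfl⟩, hb⟩ := hβ
      change β ∈ brkt α δ θ s e at hb
      change PosoComb α (-e) at hen
      have hne := ax_neg_mem h he
      have hlt : B e lam < 0 := by
        by_contra hcon
        push Not at hcon
        apply heK
        have h0 := ax_pair_nonneg h hne hen hdom
        have hz : B (-e) lam = 0 := by
          have : B (-e) lam = - B e lam := by simp
          linarith
        have hmem : -e ∈ DeloJ α s K := by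
          refine ax_supp_mem h (ax_DeloJ_sub α s hne) hen fun i hi => ?_
          by_cases hiJ : i ∈ J
          · rw [axc_span h hne] at hz
            simp only [map_sum, map_smul, LinearMap.sum_apply, LinearMap.smul_apply,
              smul_eq_mul] at hz
            have hnn : ∀ k ∈ Finset.univ, 0 ≤ axc h k (-e) * B (α k) lam := by
              intro k _
              by_cases hk : k ∈ J
              · exact mul_nonneg (axc_nonneg h hen k) (hdom k hk)
              · simp [axc_supp h hne hk]
            have := (Finset.sum_eq_zero_iff_of_nonneg hnn).1 hz i (Finset.mem_univ i)
            rcases mul_eq_zero.1 this with h1 | h1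
            · exact h1
            · exact absurd h1 (hpos i hiJ hi).ne'
          · exact axc_supp h hne hiJ
        have := ax_neg_mem h hmem
        simpa using this
      obtain ⟨⟨m, hm⟩, hre, hdel, hpc⟩ := id hb
      have hR : β ∈ DelReJ α δ s J := ⟨m, e, he, hm⟩
      obtain ⟨k, hk⟩ := exists_nat_gt ((m : ℝ) / (-(B e lam)))
      have hk' : (m : ℝ) + k * B e lam < 0 := by
        rw [div_lt_iff₀ (by linarith)] at hk
        linarith
      refine ⟨k * n, Or.inl ?_, ?_⟩
      · simp only [brSet, Set.mem_iUnion]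
        exact ⟨e, he, hb⟩
      · have hpk : pre (k * n) = tl ^ k := by
          have := hprek k 0
          simpa [hpre0] using this
        have hRi := (ax_WJ_R h (htk k)).2 _ hR
        have hBβ : B β lam = B e lam := by rw [hm]; simp [hd]
        have hform : -((tl ^ k)⁻¹ β) = (-(m + k * B e lam)) • δ + (-e) := by
          rw [ax_transl_inv_pow h hd htrans k (ax_R_in_span h hR), hBβ, hm,
            ← Int.cast_smul_eq_zsmul ℝ]
          push_cast
          module
        rw [hpk]
        refine ⟨Or.inl ?_, ?_⟩
        · obtain ⟨m', e', he', hme⟩ := hRi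
          rw [hme]
          exact ⟨-m', -e', ax_DeloJ_sub α s (ax_neg_mem h he'), by rw [neg_smul]; abel⟩
        · rw [hform]
          exact ax_PosComb h (by linarith) hen

end
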